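/- arXiv:2409.17822 — 2 statements merged into one kernel-verified Lean document; each statement's English description precedes it below -/
import Mathlib

section
/- Let σ₁, σ₂, σ₃ be real numbers and let F = diag(σ₁, σ₂, σ₃) be the corresponding 3×3 real diagonal matrix. Define the ℝ-linear endomorphism T of the space of 3×3 real matrices by T(A) = (adjugate (F + A))ᵀ − (adjugate F)ᵀ − (adjugate A)ᵀ (the tensor cross product F ⨯ A). Then the characteristic polynomial of T equals (X³ − (σ₁² + σ₂² + σ₃²)·X − 2σ₁σ₂σ₃)·(X² − σ₁²)·(X² − σ₂²)·(X² − σ₃²). In particular, six of the nine eigenvalues of the Hessian of the determinant at F are ±σ₁, ±σ₂, ±σ₃, and the remaining three are the roots of the stated cubic. -/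
open Matrix Polynomial

/-- The tensor cross product `F ⨯ A := (adjugate (F + A))ᵀ − (adjugate F)ᵀ − (adjugate A)ᵀ` on
`3 × 3` real matrices, as an `ℝ`-linear endomorphism in `A` for fixed `F`.  It is the Hessian
operator of the determinant at `F`. -/
noncomputable def tensorCrossLM (F : Matrix (Fin 3) (Fin 3) ℝ) :
    Matrix (Fin 3) (Fin 3) ℝ →ₗ[ℝ] Matrix (Fin 3) (Fin 3) ℝ where
  toFun A := (Matrix.adjugate (F + A))ᵀ - (Matrix.adjugate F)ᵀ - (Matrix.adjugate A)ᵀ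
  map_add' A B := by
    ext i j
    fin_cases i <;> fin_cases j <;>
      simp [Matrix.adjugate_fin_three, Matrix.transpose_apply, Matrix.add_apply,
        Matrix.sub_apply, Matrix.vecHead, Matrix.vecTail] <;> ring
  map_smul' c A := by
    ext i j
    fin_cases i <;> fin_cases j <;>
      simp [Matrix.adjugate_fin_three, Matrix.transpose_apply, Matrix.add_apply,
        Matrix.sub_apply, Matrix.smul_apply, Matrix.vecHead, Matrix.vecTail] <;> ring

/-- Split a `3 × 3` matrix into its diagonal and the three pairs of transposed
off-diagonal entries, which are the invariant subspaces of the Hessian. -/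
noncomputable def splitEquiv : Matrix (Fin 3) (Fin 3) ℝ ≃ₗ[ℝ]
    ((Fin 3 → ℝ) × (Fin 2 → ℝ)) × ((Fin 2 → ℝ) × (Fin 2 → ℝ)) where
  toFun A := ((![A 0 0, A 1 1, A 2 2], ![A 1 2, A 2 1]), (![A 0 2, A 2 0], ![A 0 1, A 1 0]))
  invFun v := !![v.1.1 0, v.2.2 0, v.2.1 0; v.2.2 1, v.1.1 1, v.1.2 0; v.2.1 1, v.1.2 1, v.1.1 2]
  map_add' A B := by
    ext i <;> fin_cases i <;> simp
  map_smul' c A := by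
    ext i <;> fin_cases i <;> simp
  left_inv A := by
    ext i j
    fin_cases i <;> fin_cases j <;> simp
  right_inv v := by
    ext i <;> fin_cases i <;> simp

/-- The block on the pair of transposed off-diagonal entries. -/
noncomputable def swapBlock (s : ℝ) : Matrix (Fin 2) (Fin 2) ℝ := !![0, -s; -s, 0]

/-- The block on the diagonal entries. -/
noncomputable def diagBlock (a b c : ℝ) : Matrix (Fin 3) (Fin 3) ℝ :=
  !![0, c, b; c, 0, a; b, a, 0]

lemma charpoly_swapBlock (s : ℝ) : (swapBlock s).charpoly = X ^ 2 - C (s ^ 2) := by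
  simp [swapBlock, Matrix.charpoly, Matrix.charmatrix, Matrix.det_fin_two]
  ring

lemma charpoly_diagBlock (a b c : ℝ) : (diagBlock a b c).charpoly =
    X ^ 3 - C (a ^ 2 + b ^ 2 + c ^ 2) * X - C (2 * a * b * c) := by
  simp [diagBlock, Matrix.charpoly, Matrix.charmatrix, Matrix.det_fin_three]
  rw [show (C (2 : ℝ) : ℝ[X]) = 2 from map_ofNat C 2]
  ring

lemma conj_tensorCrossLM (a b c : ℝ) :
    splitEquiv.conj (tensorCrossLM (Matrix.diagonal ![a, b, c])) =
      ((Matrix.toLin' (diagBlock a b c)).prodMap (Matrix.toLin' (swapBlock a))).prodMap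
        ((Matrix.toLin' (swapBlock b)).prodMap (Matrix.toLin' (swapBlock c))) := by
  refine LinearMap.ext fun v => ?_
  rw [LinearEquiv.conj_apply_apply]
  ext i <;> fin_cases i <;>
    simp [-Matrix.adjugate_diagonal, splitEquiv, tensorCrossLM, diagBlock, swapBlock, Matrix.adjugate_fin_three,
      Matrix.mulVec, dotProduct, Fin.sum_univ_succ, Matrix.diagonal_apply] <;> ring

/-- The characteristic polynomial of the Hessian of the determinant at
`F = diag (σ₁, σ₂, σ₃)`: six of the nine eigenvalues are `±σ₁, ±σ₂, ±σ₃` and the remaining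
three are the roots of `X³ − (σ₁² + σ₂² + σ₃²) X − 2 σ₁ σ₂ σ₃`. -/
theorem charpoly_tensorCrossLM_diagonal (σ₁ σ₂ σ₃ : ℝ) :
    LinearMap.charpoly (tensorCrossLM (Matrix.diagonal ![σ₁, σ₂, σ₃])) =
      (X ^ 3 - C (σ₁ ^ 2 + σ₂ ^ 2 + σ₃ ^ 2) * X - C (2 * σ₁ * σ₂ * σ₃)) *
        (X ^ 2 - C (σ₁ ^ 2)) * (X ^ 2 - C (σ₂ ^ 2)) * (X ^ 2 - C (σ₃ ^ 2)) := by
  rw [← LinearEquiv.charpoly_conj splitEquiv, conj_tensorCrossLM]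
  simp only [LinearMap.charpoly_prodMap, Matrix.charpoly_toLin', charpoly_swapBlock,
    charpoly_diagBlock]
  ring
end

section
/- Let det denote the determinant function on 3×3 real matrices, viewed as a smooth map from the 9-dimensional real vector space of matrices to ℝ. Then for all 3×3 real matrices F, A, B, the second derivative of det at F in the directions A and B is given by the tensor cross product: fderiv ℝ (fun X => fderiv ℝ det X A) F B = trace((adjugate (F + A) − adjugate F − adjugate A) * B). That is, the Hessian of J = det at F is the operator A ↦ F ⨯ A. -/
open Matrix

attribute [local instance] Matrix.normedAddCommGroup Matrix.normedSpace

/-- Matrix entries are differentiable functions of the matrix. -/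
theorem differentiable_entry (i j : Fin 3) :
    Differentiable ℝ (fun X : Matrix (Fin 3) (Fin 3) ℝ => X i j) :=
  (LinearMap.toContinuousLinearMap (Matrix.entryLinearMap ℝ ℝ i j)).differentiable

/-- The directional derivative is read off a cubic expansion along a line. -/
theorem fderiv_eq_of_cubic (f : Matrix (Fin 3) (Fin 3) ℝ → ℝ) (X A : Matrix (Fin 3) (Fin 3) ℝ)
    (hf : Differentiable ℝ f) (c₀ c₁ c₂ c₃ : ℝ)
    (h : ∀ t : ℝ, f (X + t • A) = c₀ + t * c₁ + t ^ 2 * c₂ + t ^ 3 * c₃) :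
    fderiv ℝ f X A = c₁ := by
  have h1 : HasLineDerivAt ℝ f (fderiv ℝ f X A) X A := (hf X).hasFDerivAt.hasLineDerivAt A
  unfold HasLineDerivAt at h1
  simp only [h] at h1
  have h2 : HasDerivAt (fun t : ℝ => c₀ + t * c₁ + t ^ 2 * c₂ + t ^ 3 * c₃) c₁ 0 := by
    have := ((((hasDerivAt_id (0 : ℝ)).mul_const c₁).const_add c₀).add
      ((hasDerivAt_pow 2 (0 : ℝ)).mul_const c₂)).add ((hasDerivAt_pow 3 (0 : ℝ)).mul_const c₃)
    exact this.congr_deriv (by simp)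
  exact h1.unique h2

/-- Jacobi's formula. -/
theorem fderiv_det_three (X A : Matrix (Fin 3) (Fin 3) ℝ) :
    fderiv ℝ (fun Y : Matrix (Fin 3) (Fin 3) ℝ => Y.det) X A = trace (adjugate X * A) := by
  have d := differentiable_entry
  refine fderiv_eq_of_cubic _ X A ?_ X.det _ (trace (adjugate A * X)) A.det ?_
  · simp only [Matrix.det_fin_three]
    fun_prop
  · intro t
    simp only [Matrix.det_fin_three, Matrix.adjugate_fin_three, Matrix.trace_fin_three,
      Matrix.mul_apply, Fin.sum_univ_three, Matrix.add_apply, Matrix.smul_apply, smul_eq_mul]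
    simp
    ring

/-- The Hessian of the determinant `J = det` on `3 × 3` real matrices at `F`, in the directions
`A` and `B`, is the Frobenius pairing of the tensor cross product `F ⨯ A` with `B`:
`D²det(F)[A, B] = trace ((adjugate (F + A) − adjugate F − adjugate A) * B)`. -/
theorem secondDeriv_det_eq_tensorCross (F A B : Matrix (Fin 3) (Fin 3) ℝ) :
    fderiv ℝ (fun X : Matrix (Fin 3) (Fin 3) ℝ =>
        fderiv ℝ (fun Y : Matrix (Fin 3) (Fin 3) ℝ => Y.det) X A) F B =
      Matrix.trace ((Matrix.adjugate (F + A) - Matrix.adjugate F - Matrix.adjugate A) * B) := by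
  have d := differentiable_entry
  simp only [fderiv_det_three]
  refine fderiv_eq_of_cubic _ F B ?_ (trace (adjugate F * A)) _ (trace (adjugate B * A)) 0 ?_
  · simp only [Matrix.adjugate_fin_three, Matrix.trace_fin_three,
      Matrix.mul_apply, Fin.sum_univ_three]
    simp
    fun_prop
  · intro t
    simp only [Matrix.adjugate_fin_three, Matrix.trace_fin_three,
      Matrix.mul_apply, Fin.sum_univ_three, Matrix.add_apply, Matrix.sub_apply,
      Matrix.smul_apply, smul_eq_mul]
    simp
    ring
end
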